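/- For all natural numbers alpha, beta >= 1 with n := alpha + beta, one has lambdaL alpha * lambdaL beta * lambdaA n ≠ lambdaA alpha * lambdaA beta * lambdaL n in ℚ. (Since all lambda's are nonzero, this is equivalent to lambda_alpha^L lambda_beta^L / lambda_n^L ≠ lambda_alpha^A lambda_beta^A / lambda_n^A, which via the identities lambda_n^L + mu^L = lambda_alpha^L lambda_beta^L and lambda_n^A + mu^A = lambda_alpha^A lambda_beta^A is exactly the inequality mu^L/lambda_n^L ≠ mu^A/lambda_n^A of the paper's Proposition, the computational core of the implication: if a 4n-dimensional oriented manifold has p_j = 0 for j ≠ alpha, beta, n, p_alpha p_beta ≠ 0 and vanishing L-genus, then its Â-genus is nonzero.) -/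

import Mathlib

open Nat

/-- The paper's Bernoulli numbers: `B j = (-1)^(j-1) * bernoulli (2j)`,
defined by `x / tanh x = 1 + ∑_{j ≥ 1} (-1)^(j-1) B_j (2x)^(2j) / (2j)!`. -/
def B (j : ℕ) : ℚ := (-1) ^ (j - 1) * bernoulli (2 * j)

/-- `lambdaL j` is the coefficient of the Pontryagin class `p_j` in the degree-`4j`
Hirzebruch `L`-polynomial `L_j`. -/
def lambdaL (j : ℕ) : ℚ := 2 ^ (2 * j) * (2 ^ (2 * j - 1) - 1) * B j / ((2 * j)! : ℚ)

/-- `lambdaA j` is the coefficient of the Pontryagin class `p_j` in the degree-`4j`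
`Â`-polynomial `Â_j`. -/
def lambdaA (j : ℕ) : ℚ := -B j / (2 * ((2 * j)! : ℚ))

theorem B_pos {j : ℕ} (hj : 1 ≤ j) : 0 < B j := by
  have hs := hasSum_zeta_nat (Nat.one_le_iff_ne_zero.mp hj)
  have hpos := hs.summable.tsum_pos (fun n => by positivity) 1 (by simp)
  rw [hs.tsum_eq] at hpos
  have hB : (-1 : ℝ) ^ (j + 1) * 2 ^ (2 * j - 1) * Real.pi ^ (2 * j) *
      bernoulli (2 * j) / (2 * j)! =
      2 ^ (2 * j - 1) * Real.pi ^ (2 * j) / (2 * j)! * (B j : ℝ) := by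
    obtain ⟨k, rfl⟩ := Nat.exists_eq_add_of_le' hj
    simp only [B, Nat.add_sub_cancel]
    push_cast
    ring
  rw [hB] at hpos
  exact_mod_cast pos_of_mul_pos_right hpos (by positivity)

theorem lambdaL_pos {j : ℕ} (hj : 1 ≤ j) : 0 < lambdaL j := by
  have hB := B_pos hj
  have h2 : (0 : ℚ) < 2 ^ (2 * j - 1) - 1 :=
    sub_pos.mpr (one_lt_pow₀ one_lt_two (by omega))
  unfold lambdaL
  positivity

theorem lambdaA_neg {j : ℕ} (hj : 1 ≤ j) : lambdaA j < 0 :=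
  div_neg_of_neg_of_pos (neg_neg_of_pos (B_pos hj)) (by positivity)

/-- The computational core of the paper'"'"'s Proposition:
`λ_α^L λ_β^L / λ_n^L ≠ λ_α^Â λ_β^Â / λ_n^Â` for `n = α + β`, i.e. `μ^L/λ_n^L ≠ μ^Â/λ_n^Â`. -/
theorem lambda_ne (alpha beta : ℕ) (ha : 1 ≤ alpha) (hb : 1 ≤ beta) :
    lambdaL alpha * lambdaL beta * lambdaA (alpha + beta) ≠
      lambdaA alpha * lambdaA beta * lambdaL (alpha + beta) := by
  have hn : 1 ≤ alpha + beta := Nat.le_add_right_of_le ha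
  have hl := mul_neg_of_pos_of_neg (mul_pos (lambdaL_pos ha) (lambdaL_pos hb)) (lambdaA_neg hn)
  have hr := mul_pos (mul_pos_of_neg_of_neg (lambdaA_neg ha) (lambdaA_neg hb)) (lambdaL_pos hn)
  exact (hl.trans hr).ne
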